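/- arXiv:1108.6092 — 2 statements merged into one kernel-verified Lean document; each statement's English description precedes it below -/
import Mathlib

section
/- Let ⟨·|·⟩: W × W* → ℂ be the natural pairing, which satisfies ⟨E^{ab} w | w*⟩ = ⟨w | −E^{ab} w* + δ_{ab} w*⟩. Then the pairing T(W,γ,h) × T(W*,γ,h) → ℂ given by ⟨q^μ ⊗ w ⊗ v_h | q^η ⊗ w* ⊗ v_h⟩ = δ_{μ,η} ⟨w | w*⟩ is a non-degenerate pairing of 𝒟_0⋉𝒦_0-modules satisfying ⟨x u | v⟩ = ⟨u | σ(x) v⟩ for all x ∈ 𝒟_0⋉𝒦_0. -/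
noncomputable section

/-- The space `q^γ ℂ[q_1^{±1},…,q_N^{±1}] ⊗ W ⊗ ℂv_h`. -/
abbrev TM (N : ℕ) (W : Type*) [AddCommGroup W] [Module ℂ W] : Type _ :=
  (Fin N → ℤ) →₀ W

/-- The action of `t^r d_a` (`a = 1,…,N`) on the tensor module. -/
noncomputable def tact {N : ℕ} {W : Type*} [AddCommGroup W] [Module ℂ W]
    (ρ : Fin N → Fin N → Module.End ℂ W) (γ : Fin N → ℂ)
    (r : Fin N → ℤ) (a : Fin N) : Module.End ℂ (TM N W) :=
  Finsupp.lsum ℂ fun μ => (Finsupp.lsingle (μ + r) : W →ₗ[ℂ] TM N W) ∘ₗ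
    ((γ a + (μ a : ℂ)) • (LinearMap.id : W →ₗ[ℂ] W) + ∑ p : Fin N, (r p : ℂ) • ρ p a)

/-- The family of operators `ρ p a` is a representation of `gl_N`. -/
def IsGLRep {N : ℕ} {W : Type*} [AddCommGroup W] [Module ℂ W]
    (ρ : Fin N → Fin N → Module.End ℂ W) : Prop :=
  ∀ p a b c, ⁅ρ p a, ρ b c⁆ =
    (if a = b then ρ p c else 0) - (if c = p then ρ b a else 0)

/-- The shift operator `q^μ ⊗ w ↦ q^{μ+m} ⊗ w` on the tensor module. -/
noncomputable def shOp {N : ℕ} {W : Type*} [AddCommGroup W] [Module ℂ W]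
    (m : Fin N → ℤ) : Module.End ℂ (TM N W) :=
  Finsupp.lmapDomain W ℂ (· + m)

/-- The Casimir operator of `sl_N` acting on `W`:
`Σ_{i,j} ρ(Ẽ^{ij}) ρ(Ẽ^{ji})` where `Ẽ^{ij} = E^{ij} − δ_{ij} I/N`. -/
noncomputable def casOp {N : ℕ} {W : Type*} [AddCommGroup W] [Module ℂ W]
    (ρ : Fin N → Fin N → Module.End ℂ W) : Module.End ℂ W :=
  ∑ i : Fin N, ∑ j : Fin N,
    (ρ i j - if i = j then ((N : ℂ))⁻¹ • ∑ c : Fin N, ρ c c else 0) ∘ₗ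
    (ρ j i - if j = i then ((N : ℂ))⁻¹ • ∑ c : Fin N, ρ c c else 0)

/-- The pairing of `T(W,γ,h)` and `T(W*,γ,h)` induced by a pairing `B` of `W` and `W*`:
`⟨q^μ ⊗ w ⊗ v_h | q^η ⊗ w* ⊗ v_h⟩ = δ_{μ,η} ⟨w | w*⟩`. -/
noncomputable def pairT {N : ℕ} {W W' : Type*} [AddCommGroup W] [Module ℂ W]
    [AddCommGroup W'] [Module ℂ W'] (B : W →ₗ[ℂ] W' →ₗ[ℂ] ℂ) :
    TM N W →ₗ[ℂ] TM N W' →ₗ[ℂ] ℂ :=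
  Finsupp.lsum ℂ fun μ =>
    ((LinearMap.llcomp ℂ (TM N W') W' ℂ).flip (Finsupp.lapply μ)) ∘ₗ B

theorem pairT_single {N : ℕ} {W W' : Type*} [AddCommGroup W] [Module ℂ W]
    [AddCommGroup W'] [Module ℂ W'] (B : W →ₗ[ℂ] W' →ₗ[ℂ] ℂ)
    (μ : Fin N → ℤ) (w : W) (v : TM N W') :
    pairT B (Finsupp.single μ w) v = B w (v μ) := by
  simp [pairT]

theorem pairT_ext {N : ℕ} {W W' : Type*} [AddCommGroup W] [Module ℂ W]
    [AddCommGroup W'] [Module ℂ W'] (B : W →ₗ[ℂ] W' →ₗ[ℂ] ℂ)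
    (S : Module.End ℂ (TM N W)) (S' : Module.End ℂ (TM N W'))
    (H : ∀ μ w η w', pairT B (S (Finsupp.single μ w)) (Finsupp.single η w') =
      pairT B (Finsupp.single μ w) (S' (Finsupp.single η w')))
    (u : TM N W) (v : TM N W') : pairT B (S u) v = pairT B u (S' v) := by
  induction u using Finsupp.induction_linear with
  | zero => simp
  | add f g hf hg => simp only [map_add, LinearMap.add_apply, hf, hg]
  | single μ w =>
    induction v using Finsupp.induction_linear with
    | zero => simp
    | add f g hf hg => simp only [map_add, hf, hg]
    | single η w' => exact H μ w η w'

theorem pairT_sh {N : ℕ} {W W' : Type*} [AddCommGroup W] [Module ℂ W]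
    [AddCommGroup W'] [Module ℂ W'] (B : W →ₗ[ℂ] W' →ₗ[ℂ] ℂ) (r : Fin N → ℤ)
    (u : TM N W) (v : TM N W') :
    pairT B (shOp r u) v = pairT B u (shOp (-r) v) := by
  apply pairT_ext
  intro μ w η w'
  simp only [shOp, Finsupp.lmapDomain_apply, Finsupp.mapDomain_single, pairT_single]
  by_cases e : η = μ + r
  · subst e; simp
  · have hne : η + -r ≠ μ := fun k => e (by rw [← k]; simp)
    rw [Finsupp.single_eq_of_ne' e, Finsupp.single_eq_of_ne' hne]

/-- the pairing `⟨q^μ ⊗ w ⊗ v_h | q^η ⊗ w* ⊗ v_h⟩ = δ_{μ,η} ⟨w|w*⟩` of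
`T(W,γ,h)` and `T(W*,γ,h)` induced by the natural pairing of `W` and `W*` is a
non-degenerate pairing of `𝒟_0 ⋉ 𝒦_0`-modules, contragredient with respect to the
anti-involution `σ(t^r x) = t^{−r} x`: `t^r k_0` acts by the shift by `r`, `t^r k_a`
acts by `0`, `t^r d_a` acts by the tensor module action, and `t^r d_0` acts by the
`β`-shift with `β = −h − Ω_W/(2(N+1)) − α(α−N)/(2N)` (the value of `β` being the same
for `W` and `W*`). -/
theorem stmt10 {N : ℕ} (hN : 1 ≤ N) {W W' : Type*}
    [AddCommGroup W] [Module ℂ W] [FiniteDimensional ℂ W] [Nontrivial W]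
    [AddCommGroup W'] [Module ℂ W'] [FiniteDimensional ℂ W'] [Nontrivial W']
    (ρ : Fin N → Fin N → Module.End ℂ W) (hρ : IsGLRep ρ)
    (ρ' : Fin N → Fin N → Module.End ℂ W') (hρ' : IsGLRep ρ')
    (hirr : ∀ P : Submodule ℂ W, (∀ p a, ∀ w ∈ P, ρ p a w ∈ P) → P = ⊥ ∨ P = ⊤)
    (γ : Fin N → ℂ) (h α Ω : ℂ)
    (hα : (∑ c : Fin N, ρ c c) = α • 1)
    (hΩ : casOp ρ = Ω • 1)
    (B : W →ₗ[ℂ] W' →ₗ[ℂ] ℂ)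
    (hBnd₁ : ∀ w : W, w ≠ 0 → ∃ w', B w w' ≠ 0)
    (hBnd₂ : ∀ w' : W', w' ≠ 0 → ∃ w, B w w' ≠ 0)
    (hBcontra : ∀ (a b : Fin N) (w : W) (w' : W'),
      B (ρ a b w) w' = B w ((if a = b then w' else 0) - ρ' a b w')) :
    (∀ (r : Fin N → ℤ) (u : TM N W) (v : TM N W'),
        pairT B (shOp r u) v = pairT B u (shOp (-r) v)) ∧
    (∀ (u : TM N W) (v : TM N W'),
        pairT B ((0 : Module.End ℂ (TM N W)) u) v =
          pairT B u ((0 : Module.End ℂ (TM N W')) v)) ∧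
    (∀ (r : Fin N → ℤ) (a : Fin N) (u : TM N W) (v : TM N W'),
        pairT B (tact ρ γ r a u) v = pairT B u (tact ρ' γ (-r) a v)) ∧
    (∀ (r : Fin N → ℤ) (u : TM N W) (v : TM N W'),
        pairT B (((-h - Ω / (2 * (N + 1)) - α * (α - N) / (2 * N)) • shOp r) u) v =
          pairT B u (((-h - Ω / (2 * (N + 1)) - α * (α - N) / (2 * N)) • shOp (-r)) v)) ∧
    (∀ u : TM N W, u ≠ 0 → ∃ v, pairT B u v ≠ 0) ∧
    (∀ v : TM N W', v ≠ 0 → ∃ u, pairT B u v ≠ 0) := by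
  refine ⟨pairT_sh B, by simp, ?_, ?_, ?_, ?_⟩
  · intro r a
    apply pairT_ext
    intro μ w η w'
    simp only [tact, Finsupp.lsum_single, LinearMap.comp_apply, Finsupp.lsingle_apply,
      pairT_single]
    by_cases e : η = μ + r
    · subst e
      have hne : μ + r + -r = μ := by simp
      rw [hne, Finsupp.single_eq_same, Finsupp.single_eq_same]
      simp only [LinearMap.add_apply, LinearMap.smul_apply, LinearMap.id_apply,
        LinearMap.sum_apply, map_add, map_sum, map_smul, hBcontra, map_sub, smul_eq_mul,
        Pi.neg_apply, Pi.add_apply, Int.cast_neg, Int.cast_add, mul_sub,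
        Finset.sum_sub_distrib, neg_mul, Finset.sum_neg_distrib]
      have : ∑ p : Fin N, (r p : ℂ) * B w (if p = a then w' else 0) = r a * B w w' := by
        rw [Finset.sum_eq_single a]
        · simp
        · intro b _ hb; simp [hb]
        · simp
      rw [this]
      ring
    · have hne : η + -r ≠ μ := fun k => e (by rw [← k]; simp)
      rw [Finsupp.single_eq_of_ne' e, Finsupp.single_eq_of_ne' hne]
      simp
  · intro r u v
    simp only [LinearMap.smul_apply, map_smul, pairT_sh]
  · intro u hu
    obtain ⟨μ, hμ⟩ := Finsupp.ne_iff.mp hu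
    obtain ⟨w', hw'⟩ := hBnd₁ (u μ) hμ
    refine ⟨Finsupp.single μ w', ?_⟩
    have key : pairT B u (Finsupp.single μ w') = B (u μ) w' := by
      clear hu hμ hw'
      induction u using Finsupp.induction_linear with
      | zero => simp
      | add f g hf hg => simp only [map_add, LinearMap.add_apply, Finsupp.add_apply, hf, hg]
      | single η w =>
        rw [pairT_single]
        by_cases e : η = μ
        · subst e; simp
        · rw [Finsupp.single_eq_of_ne' (Ne.symm e), Finsupp.single_eq_of_ne' e]
          simp
    rwa [key]
  · intro v hv
    obtain ⟨μ, hμ⟩ := Finsupp.ne_iff.mp hv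
    obtain ⟨w, hw⟩ := hBnd₂ (v μ) hμ
    exact ⟨Finsupp.single μ w, by rwa [pairT_single]⟩

end
end

section
/- Let α ∈ ℂ and let ĝ ∈ ℂ[x_1,x_2,…] be a non-constant polynomial that is homogeneous in both length and degree and satisfies Q(r,z)_− ĝ = 0. Then len(ĝ) = 1 and α = 1 − deg(ĝ). -/
open MvPolynomial

noncomputable section

/-- The polynomial ring `ℂ[x_1, x_2, …]` in countably many variables. -/
abbrev Pol : Type := MvPolynomial ℕ+ ℂ

/-- `Fop t m` is the coefficient of `z^{-m}` in the `t`-th power of the operator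
`E(z) = Σ_{j≥1} z^{-j} ∂/∂x_j`, i.e. the sum of `∂_{j_1} ∘ ⋯ ∘ ∂_{j_t}` over all
`j_1 + ⋯ + j_t = m` with `j_i ≥ 1`. -/
noncomputable def Fop : ℕ → ℕ → Module.End ℂ Pol
  | 0, m => if m = 0 then 1 else 0
  | t+1, m => ∑ j ∈ (Finset.Icc 1 m).attach,
      (pderiv (⟨j.1, by have := (Finset.mem_Icc.mp j.2).1; omega⟩ : ℕ+)).toLinearMap ∘ₗ
        Fop t (m - j.1)

/-- The coefficient of `r^s z^{-m}` in `exp(−r Σ_{j≥1} z^{-j} ∂/∂x_j)`. -/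
noncomputable def exCoef (s m : ℕ) : Module.End ℂ Pol :=
  (((-1 : ℂ) ^ s) / (s.factorial : ℂ)) • Fop s m

/-- The coefficient of `r^s z^{-j}` (`j ≥ 1`) in `Q(r,z) g`, where
`Q(r,z) = (Σ_{i≥1} x_i z^i + r Σ_{k≥1} (Σ_{i=1}^{k-1} x_i z^i) z^{-k} ∂/∂x_k + r α
− r² Σ_{k≥1} (k−1) z^{-k} ∂/∂x_k) ∘ exp(−r Σ_{j≥1} z^{-j} ∂/∂x_j)`. -/
noncomputable def qCoef (α : ℂ) (s : ℕ) (j : ℕ+) (g : Pol) : Pol :=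
  (∑ᶠ i : ℕ+, X i * (exCoef s ((i : ℕ) + (j : ℕ)) g))
  + (if s = 0 then 0 else α • exCoef (s - 1) (j : ℕ) g)
  + (if s = 0 then 0 else ∑ᶠ k : ℕ+, ∑ᶠ i : ℕ+,
      if (i : ℕ) < (k : ℕ) ∧ (k : ℕ) ≤ (i : ℕ) + (j : ℕ) then
        X i * (pderiv k (exCoef (s - 1) ((i : ℕ) + (j : ℕ) - (k : ℕ)) g)) else 0)
  - (if s ≤ 1 then 0 else ∑ᶠ k : ℕ+,
      if (k : ℕ) ≤ (j : ℕ) then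
        ((k : ℕ) - 1 : ℂ) • pderiv k (exCoef (s - 2) ((j : ℕ) - (k : ℕ)) g) else 0)


/-- derivation indexed by naturals -/
def DN (a : ℕ) : Derivation ℂ Pol Pol := if h : 0 < a then pderiv (Nat.toPNat a h) else 0

/-- variable indexed by naturals -/
def XN (a : ℕ) : Pol := if h : 0 < a then X (Nat.toPNat a h) else 0

lemma DN_zero : DN 0 = 0 := by simp [DN]
lemma XN_zero : XN 0 = 0 := by simp [XN]
lemma DN_coe (k : ℕ+) : DN (k : ℕ) = pderiv k := by
  rw [DN, dif_pos k.pos]; rfl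
lemma XN_coe (k : ℕ+) : XN (k : ℕ) = X k := by
  rw [XN, dif_pos k.pos]; rfl

lemma exists_PNat {c : ℕ} (hc : 0 < c) : ∃ k : ℕ+, c = (k : ℕ) := ⟨⟨c, hc⟩, rfl⟩

lemma DN_XN (c i : ℕ) (hc : 0 < c) : DN c (XN i) = if i = c then 1 else 0 := by
  obtain ⟨c, rfl⟩ := exists_PNat hc
  rcases Nat.eq_zero_or_pos i with rfl | hi
  · simp [XN_zero, hc.ne]
  · obtain ⟨i, rfl⟩ := exists_PNat hi
    classical
    rw [DN_coe, XN_coe, pderiv_X, Pi.single_apply]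
    simp only [PNat.coe_inj, eq_comm]

lemma pderiv_comm' (i j : ℕ+) (f : Pol) :
    pderiv (R := ℂ) i (pderiv (R := ℂ) j f) = pderiv (R := ℂ) j (pderiv (R := ℂ) i f) := by
  have h : ⁅(pderiv i : Derivation ℂ Pol Pol), (pderiv j : Derivation ℂ Pol Pol)⁆ = 0 := by
    apply MvPolynomial.derivation_ext
    intro k
    classical
    simp [Derivation.commutator_apply, pderiv_X, Pi.single_apply, apply_ite]
  have := congrArg (fun D : Derivation ℂ Pol Pol => D f) h
  simpa [Derivation.commutator_apply, sub_eq_zero] using this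

lemma DN_comm (a b : ℕ) (f : Pol) : DN a (DN b f) = DN b (DN a f) := by
  rcases Nat.eq_zero_or_pos a with rfl | ha
  · simp [DN_zero]
  rcases Nat.eq_zero_or_pos b with rfl | hb
  · simp [DN_zero]
  obtain ⟨a, rfl⟩ := exists_PNat ha
  obtain ⟨b, rfl⟩ := exists_PNat hb
  simp only [DN_coe, pderiv_comm']

open Finset in
lemma tri (f : ℕ → ℕ → ℕ → Pol) (M : ℕ) :
    ∑ p ∈ antidiagonal M, ∑ q ∈ antidiagonal p.2, f p.1 q.1 q.2 =
    ∑ p ∈ antidiagonal M, ∑ q ∈ antidiagonal p.1, f q.1 q.2 p.2 := by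
  rw [Finset.sum_sigma', Finset.sum_sigma']
  refine Finset.sum_nbij' (fun x => ⟨(x.1.1 + x.2.1, x.2.2), (x.1.1, x.2.1)⟩)
    (fun x => ⟨(x.2.1, x.2.2 + x.1.2), (x.2.2, x.1.2)⟩) ?_ ?_ ?_ ?_ ?_
  · rintro ⟨⟨a, b⟩, ⟨c, e⟩⟩ h
    simp at h ⊢; omega
  · rintro ⟨⟨a, b⟩, ⟨c, e⟩⟩ h
    simp at h ⊢; omega
  · rintro ⟨⟨a, b⟩, ⟨c, e⟩⟩ h
    simp at h ⊢; omega
  · rintro ⟨⟨a, b⟩, ⟨c, e⟩⟩ h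
    simp at h ⊢; omega
  · rintro ⟨⟨a, b⟩, ⟨c, e⟩⟩ h
    simp

open Finset in
/-- left-commutation of triple sums -/
lemma tri_swap (f : ℕ → ℕ → ℕ → Pol) (M : ℕ) :
    ∑ p ∈ antidiagonal M, ∑ q ∈ antidiagonal p.2, f p.1 q.1 q.2 =
    ∑ p ∈ antidiagonal M, ∑ q ∈ antidiagonal p.2, f q.1 p.1 q.2 := by
  rw [tri, tri (fun a b c => f b a c)]
  refine Finset.sum_congr rfl fun p _ => ?_
  exact (Finset.Nat.sum_antidiagonal_swap (f := fun q => f q.1 q.2 p.2)).symm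

open Finset in
lemma Fop_succ (t m : ℕ) (g : Pol) :
    Fop (t+1) m g = ∑ p ∈ antidiagonal m, DN p.1 (Fop t p.2 g) := by
  rw [Fop, LinearMap.sum_apply,
    Finset.Nat.sum_antidiagonal_eq_sum_range_succ (fun a b => DN a (Fop t b g)),
    Finset.sum_range_succ', DN_zero]
  simp only [Derivation.coe_zero, Pi.zero_apply, add_zero]
  rw [Finset.sum_attach (Icc 1 m) (fun j => DN j (Fop t (m - j) g)) |>.symm.trans
    (Finset.sum_congr rfl ?_) |>.symm]
  · rw [Finset.range_eq_Ico, Finset.sum_Ico_add' (fun j => DN j (Fop t (m - j) g))]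
    rfl
  · intro j _
    have := (Finset.mem_Icc.mp j.2).1
    rw [DN, dif_pos (show 0 < j.1 by omega)]
    rfl

lemma Fop_zero (m : ℕ) (g : Pol) : Fop 0 m g = if m = 0 then g else 0 := by
  rw [Fop]; split_ifs <;> simp

lemma Fop_one (m : ℕ) (g : Pol) : Fop 1 m g = DN m g := by
  rw [Fop_succ, Finset.sum_eq_single (m, 0)]
  · simp [Fop_zero]
  · rintro ⟨a, b⟩ h h'
    simp at h h'
    rw [Fop_zero, if_neg (by dsimp; omega)]; simp
  · simp

lemma Fop_lt (s m : ℕ) (g : Pol) (h : m < s) : Fop s m g = 0 := by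
  induction s generalizing m with
  | zero => omega
  | succ s ih =>
    rw [Fop_succ]
    refine Finset.sum_eq_zero ?_
    rintro ⟨a, b⟩ hab
    simp at hab
    rcases Nat.eq_zero_or_pos a with rfl | ha
    · simp [DN_zero]
    · dsimp; rw [ih b (by omega)]; simp

open Finset in
lemma Fop_weight (s m : ℕ) (g : Pol) :
    ((s : ℂ) + 1) • ∑ p ∈ antidiagonal m, (p.1 : ℂ) • DN p.1 (Fop s p.2 g)
      = (m : ℂ) • Fop (s+1) m g := by
  induction s generalizing m with
  | zero =>
    rw [Fop_one, Finset.sum_eq_single (m, 0)]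
    · simp [Fop_zero]
    · rintro ⟨a, b⟩ h h'
      simp at h h'
      rw [Fop_zero, if_neg (by dsimp; omega)]; simp
    · simp
  | succ s ih =>
    have h1 : (m : ℂ) • Fop (s+1+1) m g =
        ∑ p ∈ antidiagonal m, (p.1 : ℂ) • DN p.1 (Fop (s+1) p.2 g) +
        ∑ p ∈ antidiagonal m, (p.2 : ℂ) • DN p.1 (Fop (s+1) p.2 g) := by
      rw [Fop_succ (s+1), Finset.smul_sum, ← Finset.sum_add_distrib]
      refine Finset.sum_congr rfl ?_
      rintro ⟨a, b⟩ hab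
      simp at hab
      rw [← add_smul, ← hab]; push_cast; rfl
    have h2 : ∑ p ∈ antidiagonal m, (p.2 : ℂ) • DN p.1 (Fop (s+1) p.2 g) =
        ((s : ℂ) + 1) • ∑ p ∈ antidiagonal m, (p.1 : ℂ) • DN p.1 (Fop (s+1) p.2 g) := by
      have e1 : ∀ p : ℕ × ℕ, (p.2 : ℂ) • DN p.1 (Fop (s+1) p.2 g) =
          ((s : ℂ) + 1) • ∑ q ∈ antidiagonal p.2, (q.1 : ℂ) • DN p.1 (DN q.1 (Fop s q.2 g)) := by
        intro p
        rw [← Derivation.map_smul, ← ih, Derivation.map_smul, map_sum]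
        simp only [Derivation.map_smul]
      simp only [e1]
      rw [← Finset.smul_sum, tri_swap (fun a b c => (b : ℂ) • DN a (DN b (Fop s c g)))]
      congr 1
      refine Finset.sum_congr rfl fun p _ => ?_
      rw [Fop_succ, map_sum, Finset.smul_sum]
      refine Finset.sum_congr rfl fun q _ => ?_
      rw [DN_comm]
    rw [h1, h2]
    push_cast
    module


lemma sum_PNat {A : Type} [AddCommMonoid A] (f : ℕ → A) (B : ℕ) (h0 : f 0 = 0)
    (hB : ∀ n, B ≤ n → f n = 0) :
    ∑ᶠ i : ℕ+, f i = ∑ i ∈ Finset.range B, f i := by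
  have h1 := finsum_mem_range (f := f) (g := fun i : ℕ+ => (i : ℕ)) PNat.coe_injective
  rw [← h1, finsum_mem_def, finsum_eq_sum_of_support_subset (s := Finset.range B)]
  · refine Finset.sum_congr rfl fun i _ => ?_
    rcases Nat.eq_zero_or_pos i with rfl | hi
    · simp [h0]
    · rw [Set.indicator_of_mem]
      exact ⟨⟨i, hi⟩, rfl⟩
  · intro i hi
    simp only [Finset.coe_range, Set.mem_Iio]
    by_contra hlt
    apply hi
    simp [hB i (by omega)]

lemma coeff_XD (k : ℕ+) (h : Pol) (m : ℕ+ →₀ ℕ) :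
    coeff m (X k * pderiv k h) = (m k : ℂ) * coeff m h := by
  induction h using MvPolynomial.induction_on' with
  | monomial n c =>
    rw [X_mul_pderiv_monomial, nsmul_eq_mul, ← map_natCast (C : ℂ →+* Pol), coeff_C_mul,
      coeff_monomial]
    split_ifs with e
    · rw [e]
    · simp
  | add p q hp hq => rw [map_add, mul_add, coeff_add, hp, hq, coeff_add, mul_add]

lemma euler (w : ℕ+ → ℕ) (v : ℕ → ℕ) (hv : ∀ k : ℕ+, v k = w k) (h : Pol) (n B : ℕ)
    (hh : h.IsWeightedHomogeneous w n) (hB : ∀ a, B ≤ a → DN a h = 0) :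
    ∑ i ∈ Finset.range B, (v i : ℂ) • (XN i * DN i h) = (n : ℂ) • h := by
  rw [← sum_PNat (fun i => (v i : ℂ) • (XN i * DN i h)) B (by simp [DN_zero])
    (fun n hn => by simp [hB n hn])]
  have hsub : Function.support (fun i : ℕ+ => (v i : ℂ) • (XN i * DN i h)) ⊆
      ((Finset.range B).preimage (fun i : ℕ+ => (i : ℕ)) PNat.coe_injective.injOn : Finset ℕ+) := by
    intro i hi
    simp only [Finset.coe_preimage, Finset.coe_range, Set.mem_preimage, Set.mem_Iio]
    by_contra hlt
    apply hi
    simp [hB i (by omega)]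
  rw [finsum_eq_sum_of_support_subset _ hsub]
  ext m
  simp only [coeff_sum, coeff_smul, DN_coe, XN_coe, coeff_XD, smul_eq_mul, hv]
  by_cases hm : coeff m h = 0
  · simp [hm]
  have hw := hh hm
  rw [Finsupp.weight_apply, Finsupp.sum] at hw
  rw [← hw]
  push_cast
  rw [Finset.sum_mul]
  symm
  refine Finset.sum_subset_zero_on_sdiff ?_ ?_ ?_
  · intro k hk
    simp only [Finset.mem_preimage, Finset.mem_range]
    by_contra hlt
    have h1 := hB k (by omega)
    have h2 := coeff_XD k h m
    rw [← DN_coe, h1] at h2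
    simp [hm] at h2
    simp [h2] at hk
  · intro k hk
    simp at hk
    simp [hk.2]
  · intro k hk
    simp; ring

lemma DN_wh (n a : ℕ) (h : Pol) (hh : h.IsWeightedHomogeneous (fun i : ℕ+ => (i : ℕ)) n) :
    (a ≤ n → (DN a h).IsWeightedHomogeneous (fun i : ℕ+ => (i : ℕ)) (n - a)) ∧
    (n < a → DN a h = 0) := by
  rcases Nat.eq_zero_or_pos a with rfl | ha
  · refine ⟨fun _ => ?_, fun h => by omega⟩
    rw [DN_zero]; exact isWeightedHomogeneous_zero _ _ _
  obtain ⟨a, rfl⟩ := exists_PNat ha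
  rw [DN_coe]
  refine ⟨fun hle => hh.pderiv (by omega), fun hlt => ?_⟩
  apply pderiv_eq_zero_of_notMem_vars
  intro hmem
  rw [mem_vars_iff_mem_support] at hmem
  obtain ⟨m, hm, hk⟩ := hmem
  have h1 := hh (mem_support_iff.mp hm)
  have h2 := Finsupp.le_weight (fun i : ℕ+ => (i : ℕ)) (s := a) (by positivity) m
  rw [Finsupp.weight_apply, Finsupp.sum] at h1
  have h3 := Finset.single_le_sum (f := fun i : ℕ+ => m i • (i : ℕ)) (fun _ _ => Nat.zero_le _) hk
  have h4 : 1 ≤ m a := Nat.one_le_iff_ne_zero.mpr (Finsupp.mem_support_iff.mp hk)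
  have h5 : (a : ℕ) ≤ m a * (a : ℕ) := Nat.le_mul_of_pos_left _ h4
  simp only [smul_eq_mul] at h1 h3
  omega

lemma Fop_wh (d : ℕ) (g : Pol) (hg : g.IsWeightedHomogeneous (fun i : ℕ+ => (i : ℕ)) d)
    (s m : ℕ) :
    (m ≤ d → (Fop s m g).IsWeightedHomogeneous (fun i : ℕ+ => (i : ℕ)) (d - m)) ∧
    (d < m → Fop s m g = 0) := by
  induction s generalizing m with
  | zero =>
    rw [Fop_zero]
    split_ifs with h
    · subst h; simpa using hg
    · exact ⟨fun _ => isWeightedHomogeneous_zero _ _ _, fun _ => rfl⟩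
  | succ s ih =>
    rw [Fop_succ]
    constructor
    · intro hm
      apply IsWeightedHomogeneous.sum
      rintro ⟨a, b⟩ hab
      simp at hab
      have := (DN_wh _ a _ ((ih b).1 (by omega))).1 (by omega)
      rwa [show d - b - a = d - m by omega] at this
    · intro hm
      refine Finset.sum_eq_zero ?_
      rintro ⟨a, b⟩ hab
      simp at hab
      by_cases hb : d < b
      · simp [(ih b).2 hb]
      · exact (DN_wh _ a _ ((ih b).1 (by omega))).2 (by omega)

lemma DN_Fop_zero (d : ℕ) (g : Pol) (hg : g.IsWeightedHomogeneous (fun i : ℕ+ => (i : ℕ)) d)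
    (s a b : ℕ) (h : d < a + b) : DN a (Fop s b g) = 0 := by
  by_cases hb : d < b
  · simp [(Fop_wh d g hg s b).2 hb]
  · exact (DN_wh _ a _ ((Fop_wh d g hg s b).1 (by omega))).2 (by omega)

lemma Fop_hom (l : ℕ) (g : Pol) (hg : g.IsHomogeneous l) (s m : ℕ) :
    (Fop s m g).IsHomogeneous (l - s) := by
  induction s generalizing m with
  | zero =>
    rw [Fop_zero]
    split_ifs with h
    · simpa using hg
    · exact isHomogeneous_zero _ _ _
  | succ s ih =>
    rw [Fop_succ]
    apply IsHomogeneous.sum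
    rintro ⟨a, b⟩ hab
    rcases Nat.eq_zero_or_pos a with rfl | ha
    · rw [DN_zero]; exact isHomogeneous_zero _ _ _
    obtain ⟨a, rfl⟩ := exists_PNat ha
    rw [DN_coe]
    exact (ih b).pderiv

open Finset in
lemma reindex (f : ℕ → ℕ → Pol) (d i J : ℕ) (hf : ∀ a b, d < a + b → f a b = 0) :
    ∑ k ∈ range (d+1), (if i < k ∧ k ≤ i + J then f k (i + J - k) else 0) =
    ∑ p ∈ antidiagonal J, if 0 < p.1 then f (i + p.1) p.2 else 0 := by
  by_cases h : d < i + J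
  · rw [Finset.sum_eq_zero, Finset.sum_eq_zero]
    · rintro ⟨a, b⟩ hab
      simp at hab
      split_ifs
      · exact hf _ _ (by dsimp; omega)
      · rfl
    · intro k hk
      split_ifs
      · exact hf _ _ (by omega)
      · rfl
  rw [← Finset.sum_filter, ← Finset.sum_filter]
  refine Finset.sum_nbij' (fun k => (k - i, i + J - k)) (fun p => i + p.1) ?_ ?_ ?_ ?_ ?_
  · intro k hk; simp at hk ⊢; omega
  · rintro ⟨a, b⟩ hk; simp at hk ⊢; omega
  · intro k hk; simp at hk ⊢; omega
  · rintro ⟨a, b⟩ hk; simp at hk ⊢; omega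
  · intro k hk; simp at hk ⊢
    rw [show i + (k - i) = k by omega]

open Finset in
lemma main_eq (α : ℂ) (g : Pol) (d : ℕ)
    (hg : g.IsWeightedHomogeneous (fun i : ℕ+ => (i : ℕ)) d)
    (heq : ∀ (s : ℕ) (j : ℕ+), qCoef α s j g = 0) (t : ℕ) (J : ℕ) (hJ : 0 < J) :
    ∑ i ∈ range (d+1), XN i * (Fop (t+2) (i + J) g - ((t : ℂ) + 2) •
      ∑ p ∈ antidiagonal J, if 0 < p.1 then DN (i + p.1) (Fop (t+1) p.2 g) else 0)
     = (((t : ℂ) + 2) * (α + J - (t + 1))) • Fop (t+1) J g := by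
  obtain ⟨J, rfl⟩ := exists_PNat hJ
  have h := heq (t+2) J
  unfold qCoef exCoef at h
  rw [if_neg (by omega), if_neg (by omega), if_neg (by omega)] at h
  simp only [LinearMap.smul_apply, Derivation.map_smul, ← DN_coe, ← XN_coe, mul_smul_comm,
    show t + 2 - 1 = t + 1 by omega, show t + 2 - 2 = t by omega] at h
  set c : ℂ := (-1) ^ t / (t.factorial : ℂ) with hc
  have hc0 : c ≠ 0 := by
    rw [hc]; apply div_ne_zero
    · exact pow_ne_zero _ (by norm_num)
    · exact_mod_cast t.factorial_ne_zero
  have ht1 : (t : ℂ) + 1 ≠ 0 := by exact_mod_cast t.succ_ne_zero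
  have ht2 : (t : ℂ) + 2 ≠ 0 := by exact_mod_cast (t+1).succ_ne_zero
  have htf : (t.factorial : ℂ) ≠ 0 := by exact_mod_cast t.factorial_ne_zero
  have hc1 : (-1 : ℂ) ^ (t+1) / ((t+1).factorial : ℂ) = - c / (t + 1) := by
    rw [hc, Nat.factorial_succ, pow_succ]; push_cast; field_simp
  have hc2 : (-1 : ℂ) ^ (t+2) / ((t+2).factorial : ℂ) = c / ((t + 1) * (t + 2)) := by
    rw [hc, Nat.factorial_succ, Nat.factorial_succ, pow_succ, pow_succ]; push_cast
    rw [show (t : ℂ) + 1 + 1 = t + 2 by ring]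
    field_simp
  rw [hc1, hc2] at h
  rw [sum_PNat (fun i => (c / ((t + 1) * (t + 2)) : ℂ) • (XN i * Fop (t+2) (i + J) g)) (d+1)
    (by simp [XN_zero]) (fun n hn => by rw [(Fop_wh d g hg _ _).2 (by omega)]; simp)] at h
  have e3 : ∀ k : ℕ+, ∑ᶠ i : ℕ+, (if (i : ℕ) < (k : ℕ) ∧ (k : ℕ) ≤ (i : ℕ) + (J : ℕ) then
        (- c / (t + 1) : ℂ) • (XN i * (DN k (Fop (t+1) ((i : ℕ) + (J : ℕ) - (k : ℕ)) g))) else 0)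
      = ∑ i ∈ range (d+1), (if i < (k : ℕ) ∧ (k : ℕ) ≤ i + (J : ℕ) then
        (- c / (t + 1) : ℂ) • (XN i * (DN k (Fop (t+1) (i + (J : ℕ) - (k : ℕ)) g))) else 0) := by
    intro k
    refine sum_PNat (fun i => if i < (k : ℕ) ∧ (k : ℕ) ≤ i + (J : ℕ) then
        (- c / (t + 1) : ℂ) • (XN i * (DN k (Fop (t+1) (i + (J : ℕ) - (k : ℕ)) g))) else 0)
        (d+1) (by simp [XN_zero]) ?_
    intro n hn
    split_ifs
    · rw [DN_Fop_zero d g hg _ _ _ (by omega)]; simp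
    · rfl
  simp only [e3] at h
  rw [sum_PNat (fun k => ∑ i ∈ range (d+1), (if i < k ∧ k ≤ i + (J : ℕ) then
        (- c / (t + 1) : ℂ) • (XN i * (DN k (Fop (t+1) (i + (J : ℕ) - k) g))) else 0)) (d+1)
    (by simp) ?_, Finset.sum_comm] at h
  swap
  · intro n hn
    refine Finset.sum_eq_zero fun i _ => ?_
    split_ifs
    · rw [DN_Fop_zero d g hg _ _ _ (by omega)]; simp
    · rfl
  rw [sum_PNat (fun k => if k ≤ (J : ℕ) then
        ((k : ℂ) - 1) • c • DN k (Fop t ((J : ℕ) - k) g) else 0) ((J : ℕ)+1)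
    (by simp [DN_zero]) (fun n hn => by rw [if_neg (by omega)])] at h
  have e4 : ∑ k ∈ range ((J : ℕ)+1), (if k ≤ (J : ℕ) then
        ((k : ℂ) - 1) • c • DN k (Fop t ((J : ℕ) - k) g) else 0) =
      (c * (J / (t + 1) - 1)) • Fop (t+1) J g := by
    have w := Fop_weight t J g
    have w2 := Fop_succ t J g
    have : (J / ((t : ℂ) + 1)) • Fop (t+1) J g =
       ∑ p ∈ antidiagonal (J : ℕ), (p.1 : ℂ) • DN p.1 (Fop t p.2 g) := by
      rw [div_eq_inv_mul, mul_smul, ← w, smul_smul, inv_mul_cancel₀ ht1, one_smul]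
    rw [mul_smul, sub_smul, this, one_smul, w2, ← Finset.sum_sub_distrib, Finset.smul_sum,
      Finset.Nat.sum_antidiagonal_eq_sum_range_succ_mk]
    refine Finset.sum_congr rfl fun k hk => ?_
    rw [if_pos (by simp at hk; omega)]
    module
  rw [e4] at h
  have e5 : ∀ i, ∑ k ∈ range (d+1), (if i < k ∧ k ≤ i + (J : ℕ) then
        (- c / (t + 1) : ℂ) • (XN i * (DN k (Fop (t+1) (i + (J : ℕ) - k) g))) else 0) =
      (- c / (t + 1) : ℂ) • (XN i * ∑ p ∈ antidiagonal (J : ℕ),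
        if 0 < p.1 then DN (i + p.1) (Fop (t+1) p.2 g) else 0) := by
    intro i
    rw [reindex (fun a b => (- c / (t + 1) : ℂ) • (XN i * (DN a (Fop (t+1) b g)))) d i J,
      Finset.mul_sum, Finset.smul_sum]
    · refine Finset.sum_congr rfl fun p _ => ?_
      split_ifs <;> simp
    · intro a b hab
      rw [DN_Fop_zero d g hg _ _ _ hab]; simp
  simp only [e5] at h
  simp only [mul_sub, Finset.sum_sub_distrib, mul_smul_comm]
  rw [← Finset.smul_sum] at h ⊢
  rw [← Finset.smul_sum] at h
  generalize ∑ i ∈ range (d+1), XN i * Fop (t+2) (i + J) g = U at h ⊢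
  generalize (∑ i ∈ range (d+1), XN i * ∑ p ∈ antidiagonal (J : ℕ),
        if 0 < p.1 then DN (i + p.1) (Fop (t+1) p.2 g) else 0) = V at h ⊢
  generalize Fop (t+1) J g = Y at h ⊢
  have h' := congrArg (fun z => (((t + 1) * (t + 2) : ℂ) / c) • z) h
  simp only [smul_zero] at h'
  rw [← sub_eq_zero, ← h']
  simp only [smul_add, smul_sub, smul_smul]
  have k1 : ((t + 1) * (t + 2) : ℂ) / c * (c / ((t + 1) * (t + 2))) = 1 := by field_simp
  have k2 : ((t + 1) * (t + 2) : ℂ) / c * (α * (-c / (t + 1))) = -(t+2) * α := by field_simp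
  have k3 : ((t + 1) * (t + 2) : ℂ) / c * (-c / (t + 1)) = -(t+2) := by field_simp
  have k4 : ((t + 1) * (t + 2) : ℂ) / c * (c * (J / (t + 1) - 1)) = (t+2) * (J - (t + 1)) := by
    field_simp
  rw [k1, k2, k3, k4]
  module

open Finset in
lemma choose_sum (n k : ℕ) :
    ∑ q ∈ antidiagonal n, (if 0 < q.2 then (q.1.choose k : ℂ) else 0) = (n.choose (k+1) : ℂ) := by
  rw [Finset.Nat.sum_antidiagonal_eq_sum_range_succ_mk]
  dsimp only
  rw [Finset.sum_range_succ]
  simp only [Nat.sub_self, lt_irrefl, if_false, add_zero]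
  rw [Finset.sum_congr rfl (fun i hi => if_pos (by simp at hi; omega))]
  induction n with
  | zero => simp
  | succ n ih => rw [Finset.sum_range_succ, ih, Nat.choose_succ_succ]; push_cast; ring

open Finset in
lemma descent_step (d : ℕ) (β : ℂ) (h : ℕ → Pol)
    (hd : ∀ a b, d < a + b → DN a (h b) = 0)
    (hA : ∀ J, ∑ i ∈ range (d+1), XN i *
      (∑ p ∈ antidiagonal J, if 0 < p.1 then DN (i + p.1) (h p.2) else 0) = (-(β + J)) • h J)
    (k : ℕ) (hk : 0 < k)
    (hB : ∀ M, ∑ p ∈ antidiagonal M, (p.1.choose k : ℂ) • DN p.1 (h p.2) = 0) (M : ℕ) :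
    ∑ p ∈ antidiagonal M, (p.1.choose (k+1) : ℂ) • DN p.1 (h p.2) = 0 := by
  by_cases hM : d < M
  · refine Finset.sum_eq_zero ?_
    rintro ⟨a, b⟩ hab
    simp at hab
    rw [hd a b (by omega), smul_zero]
  have E : ∀ p ∈ antidiagonal M, (p.1.choose k : ℂ) •
      ((∑ q ∈ antidiagonal p.2, if 0 < q.1 then DN (p.1 + q.1) (h q.2) else 0) +
        ∑ i ∈ range (d+1), XN i * (∑ q ∈ antidiagonal p.2,
          if 0 < q.1 then DN (i + q.1) (DN p.1 (h q.2)) else 0)) =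
      (p.1.choose k : ℂ) • ((-(β + p.2)) • DN p.1 (h p.2)) := by
    rintro ⟨c, J⟩ hc
    simp only [Finset.HasAntidiagonal.mem_antidiagonal] at hc
    dsimp only
    rcases Nat.eq_zero_or_pos c with rfl | hc0
    · rw [Nat.choose_eq_zero_of_lt hk]; simp
    congr 1
    rw [← Derivation.map_smul, ← hA J, map_sum]
    simp only [Derivation.leibniz, DN_XN c _ hc0, smul_eq_mul]
    rw [Finset.sum_add_distrib, add_comm]
    congr 1
    · refine Finset.sum_congr rfl fun i _ => ?_
      rw [map_sum]
      congr 1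
      refine Finset.sum_congr rfl fun q _ => ?_
      split_ifs
      · rw [DN_comm]
      · simp
    · rw [Finset.sum_eq_single c]
      · simp
      · intro i _ hi; simp [hi]
      · intro hn; exfalso; apply hn; simp; omega
  have S := Finset.sum_congr rfl E
  simp only [smul_add] at S
  rw [Finset.sum_add_distrib] at S
  have T1 : ∑ p ∈ antidiagonal M, (p.1.choose k : ℂ) •
      (∑ q ∈ antidiagonal p.2, if 0 < q.1 then DN (p.1 + q.1) (h q.2) else 0) =
      ∑ p ∈ antidiagonal M, (p.1.choose (k+1) : ℂ) • DN p.1 (h p.2) := by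
    simp only [Finset.smul_sum]
    rw [tri (fun a b c => (a.choose k : ℂ) • if 0 < b then DN (a + b) (h c) else 0)]
    refine Finset.sum_congr rfl fun p _ => ?_
    rw [← choose_sum, Finset.sum_smul]
    refine Finset.sum_congr rfl fun q hq => ?_
    rw [Finset.HasAntidiagonal.mem_antidiagonal] at hq
    rw [hq]
    split_ifs <;> simp
  have T2 : ∑ p ∈ antidiagonal M, (p.1.choose k : ℂ) •
      ∑ i ∈ range (d+1), XN i * (∑ q ∈ antidiagonal p.2,
          if 0 < q.1 then DN (i + q.1) (DN p.1 (h q.2)) else 0) = 0 := by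
    simp only [Finset.smul_sum]
    rw [Finset.sum_comm]
    refine Finset.sum_eq_zero fun i _ => ?_
    simp only [← mul_smul_comm]
    rw [← Finset.mul_sum]
    simp only [Finset.smul_sum]
    rw [tri_swap (fun a b c => (a.choose k : ℂ) • if 0 < b then DN (i + b) (DN a (h c)) else 0)]
    rw [Finset.sum_eq_zero, mul_zero]
    intro p _
    split_ifs
    · have := congrArg (DN (i + p.1)) (hB p.2)
      simpa only [map_sum, Derivation.map_smul, map_zero] using this
    · simp
  have T3 : ∑ p ∈ antidiagonal M, (p.1.choose k : ℂ) • ((-(β + p.2)) • DN p.1 (h p.2)) =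
      ((k : ℂ) + 1) • ∑ p ∈ antidiagonal M, (p.1.choose (k+1) : ℂ) • DN p.1 (h p.2) +
      (k - β - M) • ∑ p ∈ antidiagonal M, (p.1.choose k : ℂ) • DN p.1 (h p.2) := by
    rw [Finset.smul_sum, Finset.smul_sum, ← Finset.sum_add_distrib]
    refine Finset.sum_congr rfl ?_
    rintro ⟨a, b⟩ hab
    rw [Finset.HasAntidiagonal.mem_antidiagonal] at hab
    dsimp only at hab ⊢
    have e : ((a.choose (k+1) : ℂ)) * (k + 1) = a.choose k * ((a : ℂ) - k) := by
      by_cases hak : k ≤ a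
      · have := Nat.choose_succ_right_eq a k
        rw [← Nat.cast_sub hak]
        exact_mod_cast this
      · rw [Nat.choose_eq_zero_of_lt (by omega), Nat.choose_eq_zero_of_lt (by omega)]; simp
    simp only [smul_smul]
    rw [← add_smul]
    congr 1
    rw [mul_comm ((k : ℂ) + 1), e, ← hab]
    push_cast
    ring
  rw [T1, T2, T3, hB M, smul_zero, add_zero, add_zero] at S
  have hk' : (k : ℂ) ≠ 0 := by exact_mod_cast hk.ne'
  have S2 : (k : ℂ) • ∑ p ∈ antidiagonal M, (p.1.choose (k+1) : ℂ) • DN p.1 (h p.2) = 0 := by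
    rw [add_smul, one_smul] at S
    exact (left_eq_add.mp (S.trans (add_comm _ _)))
  exact (smul_eq_zero.mp S2).resolve_left hk'

open Finset in
lemma triangular (T : ℕ → ℕ → Pol)
    (hB : ∀ k M, ∑ p ∈ antidiagonal M, (p.1.choose k : ℂ) • T p.1 p.2 = 0) (a b : ℕ) :
    T a b = 0 := by
  induction b using Nat.strong_induction_on generalizing a with
  | _ b ih =>
    have := hB a (a + b)
    rw [Finset.sum_eq_single (a, b)] at this
    · simpa using this
    · rintro ⟨x, y⟩ hxy hne
      simp at hxy hne
      dsimp only
      rcases lt_or_ge x a with hx | hx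
      · rw [Nat.choose_eq_zero_of_lt hx]; simp
      · -- here `y < b`
        have hyb : y < b := by
          rcases Nat.lt_or_ge y b with h | h
          · exact h
          · exact absurd (show y = b by omega) (hne (by omega))
        rw [ih y hyb x, smul_zero]
    · simp

lemma hom_zero (n : ℕ) (hn : 0 < n) (h : Pol) (hh : h.IsHomogeneous n)
    (hD : ∀ a, DN a h = 0) : h = 0 := by
  have := euler (1 : ℕ+ → ℕ) (fun _ => 1) (fun _ => rfl) h n 0 hh (fun a _ => hD a)
  rw [Finset.range_zero, Finset.sum_empty] at this
  exact (smul_eq_zero.mp this.symm).resolve_left (by exact_mod_cast hn.ne')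

open Finset in
lemma descent (α : ℂ) (g : Pol) (d l : ℕ)
    (hl : g.IsHomogeneous l)
    (hg : g.IsWeightedHomogeneous (fun i : ℕ+ => (i : ℕ)) d)
    (heq : ∀ (s : ℕ) (j : ℕ+), qCoef α s j g = 0) (t : ℕ) (ht : t + 1 < l)
    (hz : ∀ m, Fop (t+2) m g = 0) (m : ℕ) : Fop (t+1) m g = 0 := by
  have ht2 : (t : ℂ) + 2 ≠ 0 := by exact_mod_cast (t+1).succ_ne_zero
  have hA : ∀ J, ∑ i ∈ range (d+1), XN i *
      (∑ p ∈ antidiagonal J, if 0 < p.1 then DN (i + p.1) (Fop (t+1) p.2 g) else 0)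
        = (-((α - (t + 1)) + J)) • Fop (t+1) J g := by
    intro J
    rcases Nat.eq_zero_or_pos J with rfl | hJ
    · simp [Fop_lt (t+1) 0 g (by omega)]
    have := main_eq α g d hg heq t J hJ
    simp only [hz, zero_sub, mul_neg, mul_smul_comm, Finset.sum_neg_distrib] at this
    rw [← Finset.smul_sum, ← smul_neg, mul_smul] at this
    have := smul_right_injective Pol ht2 this
    rw [neg_smul, ← neg_eq_iff_eq_neg, this]
    congr 1; ring
  have hB : ∀ k M, ∑ p ∈ antidiagonal M, (p.1.choose k : ℂ) • DN p.1 (Fop (t+1) p.2 g) = 0 := by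
    intro k
    induction k with
    | zero => intro M; simpa using (Fop_succ (t+1) M g).symm.trans (hz M)
    | succ k ih =>
      rcases Nat.eq_zero_or_pos k with rfl | hk
      · intro M
        have := Fop_weight (t+1) M g
        rw [hz, smul_zero] at this
        have := (smul_eq_zero.mp this).resolve_left (by push_cast; rwa [add_assoc, one_add_one_eq_two])
        simpa using this
      · exact descent_step d _ (fun m => Fop (t+1) m g)
          (fun a b h => DN_Fop_zero d g hg _ _ _ h) hA k hk ih
  exact hom_zero (l - (t+1)) (by omega) _ (Fop_hom l g hl _ _)
    (fun a => triangular (fun a b => DN a (Fop (t+1) b g)) hB a m)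

open Finset in
lemma R_range (g : Pol) (i J : ℕ) :
    (∑ p ∈ antidiagonal J, if 0 < p.1 then DN (i + p.1) (DN p.2 g) else 0) =
    ∑ b ∈ range J, DN (i + J - b) (DN b g) := by
  rw [← Finset.Nat.sum_antidiagonal_swap, Finset.Nat.sum_antidiagonal_eq_sum_range_succ_mk,
    Finset.sum_range_succ]
  simp only [Prod.fst_swap, Prod.snd_swap, Nat.sub_self, lt_irrefl, if_false, add_zero]
  refine Finset.sum_congr rfl fun b hb => ?_
  rw [Finset.mem_range] at hb
  rw [if_pos (by omega), show i + (J - b) = i + J - b by omega]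

open Finset in
lemma K_sum (g : Pol) (i J : ℕ) :
    Fop 2 (i + J) g = DN i (DN J g) +
      (∑ p ∈ antidiagonal J, if 0 < p.1 then DN (i + p.1) (DN p.2 g) else 0) +
      (∑ p ∈ antidiagonal i, if 0 < p.1 then DN (J + p.1) (DN p.2 g) else 0) := by
  rw [R_range, R_range, Fop_succ]
  simp only [Fop_one]
  rw [← Finset.Nat.sum_antidiagonal_swap, Finset.Nat.sum_antidiagonal_eq_sum_range_succ_mk]
  simp only [Prod.fst_swap, Prod.snd_swap]
  rw [show (i + J).succ = J + 1 + i by omega, Finset.sum_range_add, Finset.sum_range_succ,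
    ← Finset.sum_range_reflect (fun b => DN (J + i - b) (DN b g)) i]
  rw [show i + J - J = i by omega, add_comm (∑ x ∈ range J, _) (DN i _)]
  congr 1
  refine Finset.sum_congr rfl fun x hx => ?_
  rw [Finset.mem_range] at hx
  rw [DN_comm, show J + i - (i - 1 - x) = J + 1 + x by omega,
    show i + J - (J + 1 + x) = i - 1 - x by omega]

open Finset in
lemma alpha_eq (α : ℂ) (g : Pol) (d l : ℕ) (hl0 : 0 < l) (hg0 : g ≠ 0)
    (hl : g.IsHomogeneous l)
    (hg : g.IsWeightedHomogeneous (fun i : ℕ+ => (i : ℕ)) d)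
    (heq : ∀ (s : ℕ) (j : ℕ+), qCoef α s j g = 0) :
    2 * ((α - 1) * l + d) = ((l : ℂ) - 1) * l := by
  have hB : ∀ a, d + 1 ≤ a → DN a g = 0 := fun a ha => (DN_wh d a g hg).2 (by omega)
  have e1 := euler (1 : ℕ+ → ℕ) (fun _ => 1) (fun _ => rfl) g l (d+1) hl hB
  have e2 := euler (fun i : ℕ+ => (i : ℕ)) (fun i => i) (fun _ => rfl) g d (d+1) hg hB
  have e3 : ∀ J, ∑ i ∈ range (d+1), XN i * DN i (DN J g) = ((l : ℂ) - 1) • DN J g := by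
    intro J
    have hh : (DN J g).IsHomogeneous (l - 1) := by
      rw [← Fop_one]; exact Fop_hom l g hl 1 J
    have := euler (1 : ℕ+ → ℕ) (fun _ => 1) (fun _ => rfl) (DN J g) (l - 1) (d+1) hh
      (fun a ha => by rw [DN_comm, hB a ha, map_zero])
    rw [Nat.cast_sub hl0] at this
    simpa using this
  simp only [Nat.cast_one, one_smul] at e1
  let R : ℕ → ℕ → Pol := fun i J =>
    ∑ p ∈ antidiagonal J, if 0 < p.1 then DN (i + p.1) (DN p.2 g) else 0
  have hm : ∀ J ∈ range (d+1), ∑ i ∈ range (d+1), XN J * (XN i *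
      (Fop 2 (i + J) g - (2 : ℂ) • R i J)) =
      (2 * (α - 1)) • (XN J * DN J g) + (2 : ℂ) • ((J : ℂ) • (XN J * DN J g)) := by
    intro J _
    rcases Nat.eq_zero_or_pos J with rfl | hJ
    · simp [XN_zero]
    have := main_eq α g d hg heq 0 J hJ
    simp only [Nat.cast_zero, zero_add, Fop_one] at this
    rw [← Finset.mul_sum, this, mul_smul_comm, smul_smul, ← add_smul]
    congr 1; ring
  have hs := Finset.sum_congr rfl hm
  rw [Finset.sum_add_distrib, ← Finset.smul_sum, ← Finset.smul_sum, e1, e2] at hs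
  have hsw : ∑ J ∈ range (d+1), ∑ i ∈ range (d+1), XN J * (XN i *
      (Fop 2 (i + J) g - (2 : ℂ) • R i J)) =
      ∑ J ∈ range (d+1), ∑ i ∈ range (d+1), XN J * (XN i *
      (Fop 2 (i + J) g - (2 : ℂ) • R J i)) := by
    rw [Finset.sum_comm]
    refine Finset.sum_congr rfl fun J _ => Finset.sum_congr rfl fun i _ => ?_
    rw [add_comm J i]; ring
  have hd : ∑ J ∈ range (d+1), ∑ i ∈ range (d+1), XN J * (XN i *
      (Fop 2 (i + J) g - (2 : ℂ) • R i J)) +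
      ∑ J ∈ range (d+1), ∑ i ∈ range (d+1), XN J * (XN i *
      (Fop 2 (i + J) g - (2 : ℂ) • R J i)) =
      (2 : ℂ) • ((l : ℂ) - 1) • (l : ℂ) • g := by
    rw [← e1, ← Finset.sum_add_distrib, Finset.smul_sum, Finset.smul_sum]
    refine Finset.sum_congr rfl fun J _ => ?_
    rw [← mul_smul_comm (_ : ℂ) (XN J), ← e3, ← Finset.sum_add_distrib, Finset.mul_sum,
      Finset.smul_sum]
    refine Finset.sum_congr rfl fun i _ => ?_
    have := K_sum g i J
    change _ = _ + R i J + R J i at this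
    rw [this, ← mul_add, ← mul_add, ← mul_smul_comm, ← mul_smul_comm]
    congr 2
    module
  rw [← hsw, hs, ← sub_eq_zero] at hd
  have hd' : (2 * (2 * ((α - 1) * l + d) - ((l : ℂ) - 1) * l)) • g = 0 := by
    rw [← hd]; module
  have := (smul_eq_zero.mp hd').resolve_right hg0
  linear_combination this / 2

lemma top_zero (α : ℂ) (g : Pol) (d t : ℕ) (ht : 0 < t) (hg0 : g ≠ 0)
    (hl : g.IsHomogeneous (t+1))
    (hg : g.IsWeightedHomogeneous (fun i : ℕ+ => (i : ℕ)) d)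
    (heq : ∀ (s : ℕ) (j : ℕ+), qCoef α s j g = 0) (m : ℕ) : Fop (t+1) m g = 0 := by
  have hD : ∀ a b, DN a (Fop (t+1) b g) = 0 := by
    intro a b
    have h := Fop_hom _ g hl (t+1) b
    rw [Nat.sub_self, ← totalDegree_zero_iff_isHomogeneous, totalDegree_eq_zero_iff_eq_C] at h
    rw [h, ← MvPolynomial.algebraMap_eq, Derivation.map_algebraMap]
  have hF : ∀ m, Fop (t+2) m g = 0 := by
    intro m
    rw [Fop_succ]
    exact Finset.sum_eq_zero fun p _ => hD _ _
  rcases lt_trichotomy m d with hm | hm | hm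
  · have := euler (fun i : ℕ+ => (i : ℕ)) (fun i => i) (fun _ => rfl) _ (d - m) 0
      ((Fop_wh d g hg (t+1) m).1 hm.le) (fun a _ => hD a m)
    rw [Finset.range_zero, Finset.sum_empty] at this
    refine (smul_eq_zero.mp this.symm).resolve_left ?_
    have : d - m ≠ 0 := by omega
    exact_mod_cast this
  · subst hm
    by_cases hlt : m < t + 1
    · exact Fop_lt _ _ _ hlt
    have h := main_eq α g m hg heq t m (by omega)
    simp only [hF, hD, ite_self, Finset.sum_const_zero, smul_zero, sub_zero, mul_zero] at h
    refine (smul_eq_zero.mp h.symm).resolve_left ?_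
    intro h0
    have ht2 : (t : ℂ) + 2 ≠ 0 := by exact_mod_cast (t+1).succ_ne_zero
    have ht0 : (t : ℂ) ≠ 0 := by exact_mod_cast ht.ne'
    have h1 := (mul_eq_zero.mp h0).resolve_left ht2
    have h2 := alpha_eq α g m (t+1) (by omega) hg0 hl hg heq
    push_cast at h2
    have h3 : (t : ℂ) * ((t + 1) - 2 * m) = 0 := by
      linear_combination h2 - 2 * (t + 1) * h1
    have h4 := (mul_eq_zero.mp h3).resolve_left ht0
    have h5 : t + 1 = 2 * m := by
      have : ((t + 1 : ℕ) : ℂ) = ((2 * m : ℕ) : ℂ) := by push_cast; linear_combination h4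
      exact_mod_cast this
    omega
  · exact (Fop_wh d g hg _ _).2 hm

/-- let `ĝ ∈ ℂ[x_1,x_2,…]` be a non-constant polynomial, homogeneous of
degree `ℓ` in length (each `x_i` having length 1) and of degree `d` in degree (each `x_i`
having degree `i`), satisfying `Q(r,z)_− ĝ = 0`, i.e. all the coefficients of `r^s z^{-j}`
(`s ≥ 0`, `j ≥ 1`) of `Q(r,z) ĝ` vanish.  Then `len(ĝ) = ℓ = 1` and `α = 1 − deg(ĝ)`. -/
theorem stmt15 (α : ℂ) (g : Pol) (ℓ d : ℕ)
    (hlen : g.IsHomogeneous ℓ)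
    (hdeg : g.IsWeightedHomogeneous (fun i : ℕ+ => (i : ℕ)) d)
    (hnc : ¬ ∃ c : ℂ, g = C c)
    (heq : ∀ (s : ℕ) (j : ℕ+), qCoef α s j g = 0) :
    ℓ = 1 ∧ α = 1 - (d : ℂ) := by
  have hg0 : g ≠ 0 := fun h => hnc ⟨0, by simpa using h⟩
  obtain _ | t := ℓ
  · exfalso
    rw [← totalDegree_zero_iff_isHomogeneous, totalDegree_eq_zero_iff_eq_C] at hlen
    exact hnc ⟨_, hlen⟩
  have ha := alpha_eq α g d (t+1) (by omega) hg0 hlen hdeg heq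
  rcases Nat.eq_zero_or_pos t with rfl | ht
  · refine ⟨rfl, ?_⟩
    push_cast at ha
    linear_combination ha / 2
  exfalso
  have key : ∀ k, k ≤ t → ∀ m, Fop (t - k + 1) m g = 0 := by
    intro k
    induction k with
    | zero => intro _ m; exact top_zero α g d t ht hg0 hlen hdeg heq m
    | succ k ih =>
      intro hk m
      refine descent α g d (t+1) hlen hdeg heq (t - (k+1)) (by omega) (fun m => ?_) m
      have := ih (by omega) m
      rwa [show t - k + 1 = t - (k+1) + 2 by omega] at this
  refine hg0 (hom_zero (t+1) (by omega) g hlen fun a => ?_)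
  have := key t le_rfl a
  rwa [Nat.sub_self, zero_add, Fop_one] at this

end
end
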